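/- For all integers k ≥ 1, the following identity holds: Σ_{i=0}^{k+1} binom_q(k+1,i) X₀⋯X_{i−1} Y₀⋯Y_{k−i} = (X_k + Y_k) · (Σ_{i=0}^{k} binom_q(k,i) X₀⋯X_{i−1} Y₀⋯Y_{k−i−1}) − (Y_{k−1}X_k − α(β−ε₂)q^{k−1}) · (Σ_{i=0}^{k−1} binom_q(k−1,i) X₀⋯X_{i−1} Y₀⋯Y_{k−i−2}), where empty products equal 1. -/

import Mathlib

noncomputable section

open Finset

/-- The base ring `R = ℤ[α, β, ε₁, ε₂, q]`, with variables
`av = α`, `bv = β`, `e1v = ε₁`, `e2v = ε₂`, `qv = q`. -/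
abbrev R : Type := MvPolynomial (Fin 5) ℤ

def av : R := MvPolynomial.X 0
def bv : R := MvPolynomial.X 1
def e1v : R := MvPolynomial.X 2
def e2v : R := MvPolynomial.X 3
def qv : R := MvPolynomial.X 4

/-- `[n]_q = 1 + q + ⋯ + q^(n-1)`. -/
def qnum (n : ℕ) : R := ∑ i ∈ Finset.range n, qv ^ i

/-- The Gaussian (q-)binomial coefficient. -/
def qbinom : ℕ → ℕ → R
  | _, 0 => 1
  | 0, _ + 1 => 0
  | n + 1, k + 1 => qbinom n k + qv ^ (k + 1) * qbinom n (k + 1)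

/-- `X_i = α q^i + ε₁ [i]_q`. -/
def Xv (i : ℕ) : R := av * qv ^ i + e1v * qnum i

/-- `Y_i = β q^i + ε₂ [i]_q`. -/
def Yv (i : ℕ) : R := bv * qv ^ i + e2v * qnum i

/-- `b_n = (α+β) q^n + (ε₁+ε₂)[n]_q`. -/
def bcoef (n : ℕ) : R := (av + bv) * qv ^ n + (e1v + e2v) * qnum n

/-- `λ_n = ε₁ε₂[n]_q[n-1]_q + (αε₂+βε₁) q^(n-1) [n]_q + αβ(q^(2n-1) - q^(n-1))` (for `n ≥ 1`). -/
def lcoef (n : ℕ) : R :=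
  e1v * e2v * qnum n * qnum (n - 1) + (av * e2v + bv * e1v) * qv ^ (n - 1) * qnum n
    + av * bv * (qv ^ (2 * n - 1) - qv ^ (n - 1))

/-- The transformed Al-Salam-Chihara polynomials. -/
def phat : ℕ → Polynomial R
  | 0 => 1
  | 1 => Polynomial.X + Polynomial.C (bcoef 0)
  | n + 2 => (Polynomial.X + Polynomial.C (bcoef (n + 1))) * phat (n + 1)
      - Polynomial.C (lcoef (n + 1)) * phat n

/-- `g m i` is the coefficient of `x^i` in `p̂_m(x)`. -/
def g (m i : ℕ) : R := (phat m).coeff i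

theorem qnum_zero' : qnum 0 = 0 := by simp [qnum]

theorem qnum_succ' (n : ℕ) : qnum (n + 1) = qnum n + qv ^ n := by
  simp [qnum, Finset.sum_range_succ]

theorem qnum_add' (m n : ℕ) : qnum (m + n) = qnum m + qv ^ m * qnum n := by
  induction n with
  | zero => simp [qnum_zero']
  | succ n ih => rw [← add_assoc, qnum_succ', ih, qnum_succ', pow_add]; ring

theorem qnum_geom (n : ℕ) : (qv - 1) * qnum n = qv ^ n - 1 := by
  induction n with
  | zero => simp [qnum_zero']
  | succ n ih => rw [qnum_succ', mul_add, ih, pow_succ]; ring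

theorem qbinom_zero_right' (n : ℕ) : qbinom n 0 = 1 := by
  cases n <;> simp [qbinom]

theorem qbinom_succ' (n k : ℕ) :
    qbinom (n + 1) (k + 1) = qbinom n k + qv ^ (k + 1) * qbinom n (k + 1) := by
  rw [qbinom]

theorem qbinom_vanish (n : ℕ) : ∀ k, n < k → qbinom n k = 0 := by
  induction n with
  | zero => intro k hk; cases k with
    | zero => omega
    | succ k => simp [qbinom]
  | succ n ih => intro k hk; cases k with
    | zero => omega
    | succ k => rw [qbinom_succ', ih k (by omega), ih (k + 1) (by omega)]; ring

theorem qbinom_step (n : ℕ) : ∀ i d, i + d = n →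
    qbinom n (i + 1) * qnum (i + 1) = qbinom n i * qnum d := by
  induction n with
  | zero =>
    intro i d h
    obtain rfl : i = 0 := by omega
    obtain rfl : d = 0 := by omega
    simp [qbinom, qnum_zero']
  | succ n ih =>
    intro i d h
    cases d with
    | zero => rw [qbinom_vanish (n + 1) (i + 1) (by omega), qnum_zero']; ring
    | succ d =>
      have h1 := ih i d (by omega)
      have e1 : qnum (n + 1) = qnum (i + 1) + qv ^ (i + 1) * qnum d := by
        rw [← qnum_add']; congr 1; omega
      have h2 : qbinom (n + 1) (i + 1) * qnum (i + 1) = qbinom n i * qnum (n + 1) := by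
        rw [qbinom_succ', e1]; linear_combination qv ^ (i + 1) * h1
      rw [h2]
      cases i with
      | zero =>
        obtain rfl : d = n := by omega
        rw [qbinom_zero_right', qbinom_zero_right']
      | succ j =>
        have h3 := ih j (d + 1) (by omega)
        have e2 : qnum (n + 1) = qnum (j + 1) + qv ^ (j + 1) * qnum (d + 1) := by
          rw [← qnum_add']; congr 1; omega
        rw [qbinom_succ', e2]; linear_combination h3

theorem qbinom_absorb_left (n i : ℕ) (h : i ≤ n) :
    qbinom (n + 1) (i + 1) * qnum (i + 1) = qnum (n + 1) * qbinom n i := by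
  obtain ⟨d, rfl⟩ := Nat.exists_eq_add_of_le h
  have h1 := qbinom_step (i + d) i d rfl
  have e1 : qnum (i + d + 1) = qnum (i + 1) + qv ^ (i + 1) * qnum d := by
    rw [← qnum_add']; congr 1; omega
  rw [qbinom_succ', e1]; linear_combination qv ^ (i + 1) * h1

theorem qbinom_absorb_right (n i : ℕ) (h : i ≤ n) :
    qbinom (n + 1) i * qnum (n + 1 - i) = qnum (n + 1) * qbinom n i := by
  rw [← qbinom_absorb_left n i h, qbinom_step (n + 1) i (n + 1 - i) (by omega)]

theorem sum_pascal (n : ℕ) (f : ℕ → R) :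
    ∑ i ∈ Finset.range (n + 2), qbinom (n + 1) i * f i =
      ∑ i ∈ Finset.range (n + 1), qbinom n i * (f (i + 1) + qv ^ i * f i) := by
  have h : ∑ i ∈ Finset.range (n + 1), qbinom n i * (qv ^ i * f i) =
      ∑ i ∈ Finset.range (n + 1), qv ^ (i + 1) * qbinom n (i + 1) * f (i + 1) + f 0 := by
    have h1 : ∑ i ∈ Finset.range (n + 2), qbinom n i * (qv ^ i * f i) =
        ∑ i ∈ Finset.range (n + 1), qbinom n i * (qv ^ i * f i) := by
      rw [Finset.sum_range_succ, qbinom_vanish n (n + 1) (by omega)]; ring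
    rw [← h1, Finset.sum_range_succ', qbinom_zero_right']
    simp only [pow_zero, one_mul]
    congr 1
    exact Finset.sum_congr rfl fun i _ => by ring
  simp only [mul_add, Finset.sum_add_distrib]
  rw [h, Finset.sum_range_succ', qbinom_zero_right', one_mul, ← add_assoc,
    ← Finset.sum_add_distrib]
  congr 1
  exact Finset.sum_congr rfl fun i _ => by rw [qbinom_succ']; ring

theorem sum_absorb (n : ℕ) (c e : R) (f : ℕ → R) :
    ∑ i ∈ Finset.range (n + 2),
        qbinom (n + 1) i * f i * (c * qv ^ i * qnum (n + 1 - i) + e * qnum i) =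
      qnum (n + 1) *
        ∑ i ∈ Finset.range (n + 1), qbinom n i * (c * qv ^ i * f i + e * f (i + 1)) := by
  simp only [mul_add, Finset.sum_add_distrib]
  congr 1
  · rw [Finset.sum_range_succ, Nat.sub_self, qnum_zero', Finset.mul_sum]
    simp only [mul_zero, add_zero]
    refine Finset.sum_congr rfl fun i hi => ?_
    have := qbinom_absorb_right n i (by have := Finset.mem_range.1 hi; omega)
    linear_combination f i * c * qv ^ i * this
  · rw [Finset.sum_range_succ', qnum_zero', Finset.mul_sum]
    simp only [mul_zero, add_zero]
    refine Finset.sum_congr rfl fun i hi => ?_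
    have := qbinom_absorb_left n i (by have := Finset.mem_range.1 hi; omega)
    linear_combination f (i + 1) * e * this

theorem Yv_shift (i d : ℕ) : qv ^ i * Yv d = Yv (i + d) - e2v * qnum i := by
  simp only [Yv, qnum_add', pow_add]; ring

/-- The summand without the q-binomial coefficient. -/
def Fterm (n i : ℕ) : R := (∏ t ∈ Finset.range i, Xv t) * ∏ t ∈ Finset.range (n - i), Yv t

theorem Fterm_succ_succ (n i : ℕ) : Fterm (n + 1) (i + 1) = Xv i * Fterm n i := by
  simp only [Fterm, Finset.prod_range_succ, Nat.add_sub_add_right]; ring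

theorem Fterm_succ (n i : ℕ) (h : i ≤ n) :
    qv ^ i * Fterm (n + 1) i = (Yv n - e2v * qnum i) * Fterm n i := by
  have h1 := Yv_shift i (n - i)
  rw [show i + (n - i) = n by omega] at h1
  rw [← h1, Fterm, Fterm, Nat.succ_sub h, Finset.prod_range_succ]; ring

theorem main_aux (m : ℕ) :
    ∑ i ∈ Finset.range (m + 3), qbinom (m + 2) i * Fterm (m + 2) i =
      (Xv (m + 1) + Yv (m + 1)) *
          ∑ i ∈ Finset.range (m + 2), qbinom (m + 1) i * Fterm (m + 1) i
        - (Yv m * Xv (m + 1) - av * (bv - e2v) * qv ^ m) *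
          ∑ i ∈ Finset.range (m + 1), qbinom m i * Fterm m i := by
  have A := sum_absorb m (av * (qv - 1) + e1v) e2v (Fterm (m + 1))
  have B : ∑ i ∈ Finset.range (m + 1), qbinom m i *
      ((av * (qv - 1) + e1v) * qv ^ i * Fterm (m + 1) i + e2v * Fterm (m + 1) (i + 1)) =
      ((av * (qv - 1) + e1v) * Yv m + e2v * av) *
        ∑ i ∈ Finset.range (m + 1), qbinom m i * Fterm m i := by
    rw [Finset.mul_sum]
    refine Finset.sum_congr rfl fun i hi => ?_
    have h := Fterm_succ m i (by have := Finset.mem_range.1 hi; omega)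
    have g := qnum_geom i
    rw [Fterm_succ_succ]
    simp only [Xv]
    linear_combination qbinom m i * (av * (qv - 1) + e1v) * h
      - qbinom m i * e2v * Fterm m i * av * g
  have C : qnum (m + 1) * ((av * (qv - 1) + e1v) * Yv m + e2v * av) =
      Yv m * Xv (m + 1) - av * (bv - e2v) * qv ^ m := by
    have g := qnum_geom (m + 1)
    have e : Yv m = bv * qv ^ m + e2v * (qnum (m + 1) - qv ^ m) := by
      rw [qnum_succ', Yv]; ring
    simp only [Xv]
    linear_combination Yv m * av * g - av * e
  rw [← C, mul_assoc (qnum (m + 1)), ← B, ← A, sum_pascal, Finset.mul_sum,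
    ← Finset.sum_sub_distrib]
  refine Finset.sum_congr rfl fun i hi => ?_
  have hi' : i ≤ m + 1 := by have := Finset.mem_range.1 hi; omega
  obtain ⟨d, hd⟩ := Nat.exists_eq_add_of_le hi'
  rw [Fterm_succ_succ, Fterm_succ (m + 1) i hi', hd, Nat.add_sub_cancel_left]
  have g := qnum_geom d
  simp only [Xv, qnum_add', pow_add]
  linear_combination qbinom (i + d) i * Fterm (i + d) i * av * qv ^ i * g

/-- **Proposition `prop1`.** For `k ≥ 1`,
`Σ_{i=0}^{k+1} binom_q(k+1,i) X₀⋯X_{i−1} Y₀⋯Y_{k−i}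
  = (X_k + Y_k) (Σ_{i=0}^{k} binom_q(k,i) X₀⋯X_{i−1} Y₀⋯Y_{k−i−1})
    − (Y_{k−1}X_k − α(β−ε₂)q^{k−1}) (Σ_{i=0}^{k−1} binom_q(k−1,i) X₀⋯X_{i−1} Y₀⋯Y_{k−i−2})`. -/
theorem constant_coefficient_recurrence (k : ℕ) (hk : 1 ≤ k) :
    (∑ i ∈ Finset.range (k + 2),
        qbinom (k + 1) i * (∏ t ∈ Finset.range i, Xv t) * ∏ t ∈ Finset.range (k + 1 - i), Yv t) =
      (Xv k + Yv k) *
          (∑ i ∈ Finset.range (k + 1),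
            qbinom k i * (∏ t ∈ Finset.range i, Xv t) * ∏ t ∈ Finset.range (k - i), Yv t)
        - (Yv (k - 1) * Xv k - av * (bv - e2v) * qv ^ (k - 1)) *
          (∑ i ∈ Finset.range k,
            qbinom (k - 1) i * (∏ t ∈ Finset.range i, Xv t) *
              ∏ t ∈ Finset.range (k - 1 - i), Yv t) := by
  obtain ⟨m, rfl⟩ := Nat.exists_eq_add_of_le' hk
  have := main_aux m
  simpa only [Fterm, ← mul_assoc, Nat.add_sub_cancel] using this
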